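/- The reset threshold of the automaton 𝒜_8 is exactly 20; that is, 𝒜_8 has a reset word of length 20 and no reset word of length less than 20. -/

import Mathlib

/-- The two letters of a binary alphabet. -/
inductive Letter where
  | a : Letter
  | b : Letter
deriving DecidableEq

/-- The transition function of the automaton `𝒜ₙ` on the state set
`Qₙ = {0, 1, …, n-1}` (represented inside `ℕ`):
`δ(0,a)=δ(0,b)=0`; `δ(1,a)=0`, `δ(2,a)=4`, `δ(3,a)=2`, `δ(4,a)=3`;
`δ(1,b)=3`, `δ(2,b)=1`, `δ(3,b)=2`; and for `4 ≤ j ≤ n-1`: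
`δ(j,a) = j-1` if `j ≥ 6` is even, `δ(j,a) = j+1` if `j ≥ 5` is odd and
`j ≠ n-1`, `δ(j,a) = j` if `j = n-1` is odd; `δ(j,b) = j-1` if `j ≥ 5` is odd,
`δ(j,b) = j+1` if `j ≥ 4` is even and `j ≠ n-1`, `δ(j,b) = j` if `j = n-1`
is even. -/
def anDelta (n : ℕ) (q : ℕ) (ℓ : Letter) : ℕ :=
  match q, ℓ with
  | 0, _ => 0
  | 1, Letter.a => 0
  | 1, Letter.b => 3
  | 2, Letter.a => 4
  | 2, Letter.b => 1
  | 3, _ => 2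
  | 4, Letter.a => 3
  | j, Letter.a => if j % 2 = 1 then (if j = n - 1 then j else j + 1) else j - 1
  | j, Letter.b => if j % 2 = 0 then (if j = n - 1 then j else j + 1) else j - 1

/-- Extension of the transition function of `𝒜ₙ` to words:
`δ(q, uv) = δ(δ(q, u), v)`. -/
def anStar (n : ℕ) (q : ℕ) (w : List Letter) : ℕ :=
  w.foldl (anDelta n) q

/-- The state `0` is a sink of `𝒜ₙ`. -/
lemma anStar_zero (n : ℕ) (w : List Letter) : anStar n 0 w = 0 := by
  induction w with
  | nil => rfl
  | cons ℓ w ih => cases ℓ <;> exact ih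

/-- `𝒜₈` acts on its state set `{0, …, 7}`. -/
lemma anDelta_eight_lt : ∀ q < 8, ∀ ℓ : Letter, anDelta 8 q ℓ < 8 := by
  intro q hq ℓ
  interval_cases q <;> cases ℓ <;> decide

/-- The bitmap of a set of states of `𝒜₈` given by a Boolean predicate. -/
def stateBitmap (p : ℕ → Bool) : ℕ :=
  (List.range 8).foldl (fun m q => m + 2 ^ q * (p q).toNat) 0

/-- The preimage under a letter of a set of states of `𝒜₈`, as bitmaps. -/
def preimageBitmap (m : ℕ) (ℓ : Letter) : ℕ :=
  stateBitmap fun q => m.testBit (anDelta 8 q ℓ)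

/-- A lower bound for the length of the words under which the preimage of `{0}` has a given bitmap.
The table is indexed by the sets of states containing the sink `0`. -/
def preimageRank (m : ℕ) : ℕ :=
  if m % 2 = 0 then 0 else [
    0, 1, 2, 4, 3, 3, 5, 8, 20, 4, 8, 7, 6, 6, 8, 9,
    20, 7, 5, 7, 9, 9, 8, 10, 20, 7, 8, 10, 9, 9, 11, 12,
    20, 8, 12, 8, 10, 6, 8, 9, 20, 10, 14, 10, 12, 9, 11, 12,
    20, 12, 10, 11, 14, 11, 12, 14, 20, 12, 13, 14, 14, 13, 14, 15,
    20, 11, 9, 7, 13, 8, 9, 10, 20, 9, 13, 11, 11, 10, 12, 13,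
    20, 13, 11, 10, 15, 12, 11, 13, 20, 12, 13, 13, 14, 14, 15, 15,
    20, 14, 15, 12, 16, 11, 13, 14, 20, 13, 17, 15, 15, 12, 14, 16,
    20, 16, 14, 13, 18, 14, 16, 17, 20, 15, 16, 18, 17, 17, 19, 20].getD (m / 2) 0

lemma stateBitmap_congr {p r : ℕ → Bool} (h : ∀ q < 8, p q = r q) :
    stateBitmap p = stateBitmap r := by
  simp [stateBitmap, List.range_succ, h]

lemma testBit_stateBitmap (p : ℕ → Bool) {q : ℕ} (hq : q < 8) :
    (stateBitmap p).testBit q = p q := by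
  simp only [stateBitmap, List.range_succ, List.range_zero, List.nil_append, List.cons_append,
    List.foldl_cons, List.foldl_nil]
  interval_cases q <;>
  · generalize p 0 = x0, p 1 = x1, p 2 = x2, p 3 = x3, p 4 = x4, p 5 = x5, p 6 = x6, p 7 = x7
    revert x0 x1 x2 x3 x4 x5 x6 x7
    decide +kernel

lemma stateBitmap_lt (p : ℕ → Bool) : stateBitmap p < 256 := by
  have h (q : ℕ) : (p q).toNat ≤ 1 := Bool.toNat_le (p q)
  simp only [stateBitmap, List.range_succ, List.range_zero, List.nil_append, List.cons_append,
    List.foldl_cons, List.foldl_nil]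
  linarith [h 0, h 1, h 2, h 3, h 4, h 5, h 6, h 7]

lemma preimageRank_preimageBitmap_le : ∀ m < 256,
    preimageRank (preimageBitmap m Letter.a) ≤ preimageRank m + 1 ∧
      preimageRank (preimageBitmap m Letter.b) ≤ preimageRank m + 1 := by
  decide +kernel

lemma preimageRank_stateBitmap_anStar_le (w : List Letter) :
    preimageRank (stateBitmap fun q => anStar 8 q w == 0) ≤ w.length := by
  induction w with
  | nil => decide +kernel
  | cons ℓ w ih =>
    have h : stateBitmap (fun q => anStar 8 q (ℓ :: w) == 0) =
        preimageBitmap (stateBitmap fun q => anStar 8 q w == 0) ℓ :=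
      stateBitmap_congr fun q hq => (testBit_stateBitmap
        (fun q => anStar 8 q w == 0) (anDelta_eight_lt q hq ℓ)).symm
    have hstep := preimageRank_preimageBitmap_le _
      (stateBitmap_lt fun q => anStar 8 q w == 0)
    rw [h, List.length_cons]
    cases ℓ
    · exact hstep.1.trans (Nat.succ_le_succ ih)
    · exact hstep.2.trans (Nat.succ_le_succ ih)

/-- The reset threshold of the automaton `𝒜₈` is exactly `20`: `𝒜₈` has a
reset word of length `20` and no reset word of length less than `20`. -/
theorem a8_resetThreshold :
    (∃ w : List Letter,
      (∀ p q : ℕ, p < 8 → q < 8 → anStar 8 p w = anStar 8 q w) ∧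
      w.length = 20) ∧
    (∀ w : List Letter,
      (∀ p q : ℕ, p < 8 → q < 8 → anStar 8 p w = anStar 8 q w) →
      20 ≤ w.length) := by
  constructor
  · open Letter in
    refine ⟨[a, b, a, a, b, a, a, b, b, a, b, a, b, a, a, b, b, a, b, a], ?_, rfl⟩
    have h : ∀ p < 8,
        anStar 8 p [a, b, a, a, b, a, a, b, b, a, b, a, b, a, a, b, b, a, b, a] = 0 := by
      decide +kernel
    intro p q hp hq
    rw [h p hp, h q hq]
  · intro w hw
    have h : stateBitmap (fun q => anStar 8 q w == 0) = stateBitmap fun _ => true :=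
      stateBitmap_congr fun q hq => by simp [hw q 0 hq (by simp), anStar_zero]
    have hrank : preimageRank (stateBitmap fun _ => true) = 20 := by decide +kernel
    rw [← hrank, ← h]
    exact preimageRank_stateBitmap_anStar_le w
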